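/- arXiv:1407.5490 — 5 statements merged into one kernel-verified Lean document; each statement's English description precedes it below -/
import Mathlib

section
/- For every natural number n ≥ 1 there exists a partition of n whose number of distinct part sizes is exactly ⌊(√(8n+1) − 1)/2⌋. (Such a partition can be taken to be the staircase partition d, d−1, …, 2, 1 with the leftover n − d(d+1)/2 absorbed by enlarging parts without creating new distinct sizes.) -/
/-- If the `d`-th triangular number is at most `n` and `d ≥ 1`, then `n` has a partition whose set
of part sizes is `{1, …, d}`. -/
theorem Nat.Partition.exists_toFinset_parts_eq_Icc {n d : ℕ} (hd : 1 ≤ d)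
    (h : d * (d + 1) ≤ 2 * n) : ∃ P : Nat.Partition n, P.parts.toFinset = Finset.Icc 1 d := by
  have hsum : (∑ i ∈ Finset.Icc 1 d, i) * 2 = d * (d + 1) := by
    have := Finset.sum_range_id_mul_two (d + 1)
    rw [Finset.range_eq_Ico, Finset.sum_eq_sum_Ico_succ_bot d.succ_pos] at this
    simpa [mul_comm, Finset.Ico_add_one_right_eq_Icc] using this
  refine ⟨⟨(Finset.Icc 1 d).val + Multiset.replicate (n - ∑ i ∈ Finset.Icc 1 d, i) 1, ?_, ?_⟩, ?_⟩
  · intro i hi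
    rcases Multiset.mem_add.1 hi with hi | hi
    · exact (Finset.mem_Icc.1 (Finset.mem_val.mp hi)).1
    · exact (Multiset.eq_of_mem_replicate hi).ge
  · rw [Multiset.sum_add, Finset.sum_val, Multiset.sum_replicate, smul_eq_mul, mul_one]
    exact Nat.add_sub_cancel' (by simp only [id]; omega)
  · ext i
    simp only [Multiset.mem_toFinset, Multiset.mem_add, Finset.mem_val, Multiset.mem_replicate,
      Finset.mem_Icc]
    omega

/-- For every `n ≥ 1` there is a partition of `n` whose number of distinct part sizes
is exactly `⌊(√(8n+1) − 1)/2⌋`. -/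
theorem exists_partition_distinct_parts_eq_sqrt_bound (n : ℕ) (hn : 1 ≤ n) :
    ∃ P : Nat.Partition n,
      P.parts.toFinset.card = (Nat.sqrt (8 * n + 1) - 1) / 2 := by
  have hs : 3 ≤ Nat.sqrt (8 * n + 1) := Nat.le_sqrt.2 (by omega)
  have hle := Nat.sqrt_le (8 * n + 1)
  obtain ⟨P, hP⟩ := Nat.Partition.exists_toFinset_parts_eq_Icc
    (n := n) (d := (Nat.sqrt (8 * n + 1) - 1) / 2) (by omega) (by
      have hd : 2 * ((Nat.sqrt (8 * n + 1) - 1) / 2) + 1 ≤ Nat.sqrt (8 * n + 1) := by omega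
      nlinarith [Nat.mul_le_mul hd hd])
  exact ⟨P, by rw [hP, Nat.card_Icc, Nat.add_sub_cancel]⟩
end

section
/- Let k be an algebraically closed field of characteristic 0, let R = k[X,Y] be the polynomial ring in two variables, let m = (X,Y) be the maximal ideal at the origin, and let I be a proper ideal with m^r ⊆ I ⊆ m for some r ≥ 1. Let Soc(R/I) = {a ∈ R/I : X·a = 0 and Y·a = 0} be the socle of R/I, a k-subspace of R/I. Then dim_k Soc(R/I) = dim_k (I/mI) − 1. -/
open MvPolynomial

/-- The socle of `R/I`, i.e. `{a ∈ R/I : X·a = 0 ∧ Y·a = 0}`, as a `k`-subspace. -/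
noncomputable def socle {k : Type*} [Field k] (I : Ideal (MvPolynomial (Fin 2) k)) :
    Submodule k (MvPolynomial (Fin 2) k ⧸ I) :=
  LinearMap.ker (LinearMap.mulLeft k (Ideal.Quotient.mk I (X 0))) ⊓
    LinearMap.ker (LinearMap.mulLeft k (Ideal.Quotient.mk I (X 1)))

/-- `dim_k (I / mI)` where `m = (X, Y)`: the minimal number of generators of `I`. -/
noncomputable def gensDim {k : Type*} [Field k] (I : Ideal (MvPolynomial (Fin 2) k)) : ℕ :=
  Module.finrank k
    (↥(I.restrictScalars k) ⧸
      (Submodule.comap (I.restrictScalars k).subtype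
        ((Ideal.span {X 0, X 1} * I).restrictScalars k)))

namespace MvPolynomial

variable {k : Type*} [Field k]

/-- A polynomial differs from its constant coefficient by an element of the ideal `(X, Y)`. -/
lemma sub_C_constantCoeff_mem_span (p : MvPolynomial (Fin 2) k) :
    p - C (constantCoeff p) ∈ (Ideal.span {X 0, X 1} : Ideal (MvPolynomial (Fin 2) k)) := by
  induction p using MvPolynomial.induction_on with
  | C a => simp
  | add p q hp hq =>
    have h := add_mem hp hq
    rw [map_add, map_add]
    convert h using 1
    ring
  | mul_X p i hp =>
    have hX : (X i : MvPolynomial (Fin 2) k) ∈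
        (Ideal.span {X 0, X 1} : Ideal (MvPolynomial (Fin 2) k)) := by
      apply Ideal.subset_span
      fin_cases i <;> simp
    simpa using Ideal.mul_mem_left _ p hX

lemma constantCoeff_eq_zero_of_mem_span {p : MvPolynomial (Fin 2) k}
    (hp : p ∈ (Ideal.span {X 0, X 1} : Ideal (MvPolynomial (Fin 2) k))) :
    constantCoeff p = 0 := by
  obtain ⟨a, b, rfl⟩ := Ideal.mem_span_pair.1 hp
  simp

/-- The quotient of `k[X,Y]` by an ideal containing a power of `(X, Y)` is finite-dimensional. -/
lemma finite_quotient_of_span_pow_le {J : Ideal (MvPolynomial (Fin 2) k)} {n : ℕ}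
    (h : (Ideal.span {X 0, X 1} : Ideal (MvPolynomial (Fin 2) k)) ^ n ≤ J) :
    Module.Finite k (MvPolynomial (Fin 2) k ⧸ J) := by
  have hint : ∀ i : Fin 2, IsIntegral k (Ideal.Quotient.mkₐ k J (X i)) := by
    intro i
    have hX : (X i : MvPolynomial (Fin 2) k) ^ n ∈ J := by
      apply h
      apply Ideal.pow_mem_pow
      apply Ideal.subset_span
      fin_cases i <;> simp
    refine ⟨Polynomial.X ^ n, Polynomial.monic_X_pow n, ?_⟩
    rw [Polynomial.eval₂_X_pow, ← map_pow]
    exact Ideal.Quotient.eq_zero_iff_mem.2 hX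
  have hall : ∀ p : MvPolynomial (Fin 2) k, IsIntegral k (Ideal.Quotient.mkₐ k J p) := by
    intro p
    induction p using MvPolynomial.induction_on with
    | C a => exact isIntegral_algebraMap (x := a)
    | add p q hp hq => rw [map_add]; exact hp.add hq
    | mul_X p i hp => rw [map_mul]; exact hp.mul (hint i)
  have : Algebra.IsIntegral k (MvPolynomial (Fin 2) k ⧸ J) :=
    ⟨fun a => by
      obtain ⟨p, rfl⟩ := Ideal.Quotient.mk_surjective a
      exact hall p⟩
  exact Algebra.IsIntegral.finite

lemma span_pair_mul_mem_iff {I : Ideal (MvPolynomial (Fin 2) k)} {f g : MvPolynomial (Fin 2) k} :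
    X 0 * f + X 1 * g ∈ (Ideal.span {X 0, X 1} : Ideal (MvPolynomial (Fin 2) k)) * I ↔
      ∃ h, f - X 1 * h ∈ I ∧ g + X 0 * h ∈ I := by
  rw [Ideal.span_insert, Ideal.sup_mul, Submodule.mem_sup]
  simp only [Ideal.mem_span_singleton_mul]
  constructor
  · rintro ⟨_, ⟨i, hi, rfl⟩, _, ⟨j, hj, rfl⟩, hij⟩
    have hdvd : (X 1 : MvPolynomial (Fin 2) k) ∣ X 0 * (f - i) :=
      ⟨j - g, by linear_combination -hij⟩
    rcases X_dvd_mul_iff.1 hdvd with h | ⟨h, hh⟩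
    · simp [X_dvd_X] at h
    · refine ⟨h, by rwa [← hh, sub_sub_cancel], ?_⟩
      have : (X 1 : MvPolynomial (Fin 2) k) * (g + X 0 * h) = X 1 * j := by
        linear_combination -hij - X 0 * hh
      rwa [mul_left_cancel₀ (X_ne_zero 1) this]
  · rintro ⟨h, hf, hg⟩
    exact ⟨_, ⟨_, hf, rfl⟩, _, ⟨_, hg, rfl⟩, by ring⟩

/-- Multiplication by a variable, as a map `R/I → R/(X, Y)I`. -/
noncomputable def mulVarQuotient (I : Ideal (MvPolynomial (Fin 2) k)) (i : Fin 2) :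
    (MvPolynomial (Fin 2) k ⧸ I) →ₗ[k]
      (MvPolynomial (Fin 2) k ⧸ (Ideal.span {X 0, X 1} * I)) :=
  (Submodule.mapQ I (Ideal.span {X 0, X 1} * I) (LinearMap.mulLeft (MvPolynomial (Fin 2) k) (X i))
    (fun p hp => by
      refine Ideal.mul_mem_mul (Ideal.subset_span ?_) hp
      fin_cases i <;> simp)).restrictScalars k

lemma mulVarQuotient_mk (I : Ideal (MvPolynomial (Fin 2) k)) (i : Fin 2)
    (p : MvPolynomial (Fin 2) k) :
    mulVarQuotient I i (Ideal.Quotient.mk I p) = Ideal.Quotient.mk _ (X i * p) :=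
  rfl

/-- The map `R/I → (R/I)²`, `a ↦ (Y a, -X a)`, whose kernel is the socle. -/
noncomputable def koszulMap (I : Ideal (MvPolynomial (Fin 2) k)) :
    (MvPolynomial (Fin 2) k ⧸ I) →ₗ[k]
      (MvPolynomial (Fin 2) k ⧸ I) × (MvPolynomial (Fin 2) k ⧸ I) :=
  (LinearMap.mulLeft k (Ideal.Quotient.mk I (X 1))).prod
    (-LinearMap.mulLeft k (Ideal.Quotient.mk I (X 0)))

lemma ker_koszulMap (I : Ideal (MvPolynomial (Fin 2) k)) :
    LinearMap.ker (koszulMap I) = socle I := by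
  ext a
  simp [koszulMap, socle, and_comm]

lemma ker_coprod_mulVarQuotient (I : Ideal (MvPolynomial (Fin 2) k)) :
    LinearMap.ker ((mulVarQuotient I 0).coprod (mulVarQuotient I 1)) =
      LinearMap.range (koszulMap I) := by
  ext ⟨a, b⟩
  obtain ⟨f, rfl⟩ := Ideal.Quotient.mk_surjective a
  obtain ⟨g, rfl⟩ := Ideal.Quotient.mk_surjective b
  rw [LinearMap.mem_ker, LinearMap.coprod_apply, mulVarQuotient_mk, mulVarQuotient_mk, ← map_add,
    Ideal.Quotient.eq_zero_iff_mem, span_pair_mul_mem_iff, LinearMap.mem_range,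
    Ideal.Quotient.mk_surjective.exists]
  refine exists_congr fun h => ?_
  simp only [koszulMap, LinearMap.prod_apply, Function.prod_apply, LinearMap.neg_apply,
    LinearMap.mulLeft_apply, Prod.mk.injEq, ← map_mul, ← map_neg, Ideal.Quotient.eq]
  rw [← neg_mem_iff (x := f - _), ← neg_mem_iff (x := g + _)]
  ring_nf

/-- Evaluation at the origin on `R/(X, Y)I`. -/
noncomputable def quotientConstantCoeff (I : Ideal (MvPolynomial (Fin 2) k)) :
    (MvPolynomial (Fin 2) k ⧸ (Ideal.span {X 0, X 1} * I)) →ₐ[k] k :=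
  Ideal.Quotient.liftₐ _ (aeval (0 : Fin 2 → k)) fun p hp => by
    simpa [aeval_zero] using constantCoeff_eq_zero_of_mem_span (Ideal.mul_le_left hp)

lemma quotientConstantCoeff_mk (I : Ideal (MvPolynomial (Fin 2) k)) (p : MvPolynomial (Fin 2) k) :
    quotientConstantCoeff I (Ideal.Quotient.mk _ p) = constantCoeff p := by
  change aeval (0 : Fin 2 → k) p = _
  simp [aeval_zero]

lemma range_coprod_mulVarQuotient (I : Ideal (MvPolynomial (Fin 2) k)) :
    LinearMap.range ((mulVarQuotient I 0).coprod (mulVarQuotient I 1)) =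
      LinearMap.ker (quotientConstantCoeff I).toLinearMap := by
  ext b
  constructor
  · rintro ⟨⟨a, b⟩, rfl⟩
    obtain ⟨f, rfl⟩ := Ideal.Quotient.mk_surjective a
    obtain ⟨g, rfl⟩ := Ideal.Quotient.mk_surjective b
    rw [LinearMap.mem_ker, LinearMap.coprod_apply, mulVarQuotient_mk, mulVarQuotient_mk, ← map_add,
      AlgHom.toLinearMap_apply, quotientConstantCoeff_mk]
    simp
  · intro hb
    obtain ⟨p, rfl⟩ := Ideal.Quotient.mk_surjective b
    rw [LinearMap.mem_ker, AlgHom.toLinearMap_apply, quotientConstantCoeff_mk] at hb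
    have hp := sub_C_constantCoeff_mem_span p
    rw [hb, map_zero, sub_zero] at hp
    obtain ⟨f, g, rfl⟩ := Ideal.mem_span_pair.1 hp
    refine ⟨(Ideal.Quotient.mk I f, Ideal.Quotient.mk I g), ?_⟩
    rw [LinearMap.coprod_apply, mulVarQuotient_mk, mulVarQuotient_mk, ← map_add, mul_comm f,
      mul_comm g]

lemma finrank_quotient_span_mul (I : Ideal (MvPolynomial (Fin 2) k))
    [Module.Finite k (MvPolynomial (Fin 2) k ⧸ (Ideal.span {X 0, X 1} * I))] :
    Module.finrank k (MvPolynomial (Fin 2) k ⧸ (Ideal.span {X 0, X 1} * I)) =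
      Module.finrank k (MvPolynomial (Fin 2) k ⧸ I) + gensDim I := by
  set J : Ideal (MvPolynomial (Fin 2) k) := Ideal.span {X 0, X 1} * I with hJ
  have hJI : J ≤ I := Ideal.mul_le_right
  let π := (Ideal.Quotient.factorₐ k hJI).toLinearMap
  have hπ : LinearMap.range π = ⊤ :=
    LinearMap.range_eq_top.2 (Ideal.Quotient.factor_surjective hJI)
  let α : ↥(I.restrictScalars k) →ₗ[k] MvPolynomial (Fin 2) k ⧸ J :=
    (Ideal.Quotient.mkₐ k J).toLinearMap ∘ₗ (I.restrictScalars k).subtype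
  have hker : LinearMap.ker α =
      Submodule.comap (I.restrictScalars k).subtype (J.restrictScalars k) := by
    ext p
    exact Ideal.Quotient.eq_zero_iff_mem
  have hrange : LinearMap.range α = LinearMap.ker π := by
    ext b
    obtain ⟨p, rfl⟩ := Ideal.Quotient.mk_surjective b
    constructor
    · rintro ⟨q, hq⟩
      rw [← hq]
      exact Ideal.Quotient.eq_zero_iff_mem.2 q.2
    · intro hp
      exact ⟨⟨p, Ideal.Quotient.eq_zero_iff_mem.1 hp⟩, rfl⟩
  have hgens : gensDim I = Module.finrank k (LinearMap.range α) := by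
    rw [gensDim, ← hJ, ← hker]
    exact α.quotKerEquivRange.finrank_eq
  have h := π.finrank_range_add_finrank_ker
  rw [hπ, finrank_top, ← hrange, ← hgens] at h
  exact h.symm

end MvPolynomial

/-- Lemma 2.1: for an `m`-primary ideal `I ⊆ k[X,Y]`,
`dim_k Soc(R/I) = dim_k (I/mI) − 1`. -/
theorem socle_dim_eq_gens_sub_one {k : Type*} [Field k] [IsAlgClosed k] [CharZero k]
    (I : Ideal (MvPolynomial (Fin 2) k)) (r : ℕ) (hr : 1 ≤ r)
    (hmI : (Ideal.span {X 0, X 1} : Ideal (MvPolynomial (Fin 2) k)) ^ r ≤ I)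
    (hIm : I ≤ Ideal.span {X 0, X 1}) :
    Module.finrank k ↥(socle I) = gensDim I - 1 := by
  have hfJ : Module.Finite k (MvPolynomial (Fin 2) k ⧸ (Ideal.span {X 0, X 1} * I)) :=
    finite_quotient_of_span_pow_le (n := r + 1) (by
      rw [pow_succ']
      exact Ideal.mul_mono_right hmI)
  have hfI : Module.Finite k (MvPolynomial (Fin 2) k ⧸ I) := finite_quotient_of_span_pow_le hmI
  have hsocle := (koszulMap I).finrank_range_add_finrank_ker
  have hprod := ((mulVarQuotient I 0).coprod (mulVarQuotient I 1)).finrank_range_add_finrank_ker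
  have hconst := (quotientConstantCoeff I).toLinearMap.finrank_range_add_finrank_ker
  have hsurj : LinearMap.range (quotientConstantCoeff I).toLinearMap = ⊤ :=
    LinearMap.range_eq_top.2 fun c => ⟨algebraMap k _ c, (quotientConstantCoeff I).commutes c⟩
  have hgens := finrank_quotient_span_mul I
  rw [ker_koszulMap] at hsocle
  rw [ker_coprod_mulVarQuotient, range_coprod_mulVarQuotient, Module.finrank_prod] at hprod
  rw [hsurj, finrank_top, Module.finrank_self] at hconst
  omega
end

section
/- Let k be an algebraically closed field of characteristic 0, R = k[X,Y], m = (X,Y), and let I be a proper ideal with m^r ⊆ I ⊆ m for some r ≥ 1. Set n = dim_k (R/I) and let b₂ = dim_k Soc(R/I), where Soc(R/I) = {a ∈ R/I : X·a = 0 and Y·a = 0}. Then b₂ ≤ ⌊(√(8n+1) − 1)/2⌋. -/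
open MvPolynomial

/-- Restriction of a polynomial to the line through `v`, as a polynomial in the parameter. -/
noncomputable def restrictToLine {σ k : Type*} [CommSemiring k] (v : σ → k) :
    MvPolynomial σ k →ₐ[k] Polynomial k :=
  aeval fun i => Polynomial.C (v i) * Polynomial.X

theorem restrictToLine_monomial {σ k : Type*} [CommSemiring k] (v : σ → k) (s : σ →₀ ℕ) (a : k) :
    restrictToLine v (monomial s a) =
      Polynomial.C (eval v (monomial s a)) * Polynomial.X ^ s.degree := by
  simp [restrictToLine, aeval_monomial, eval_monomial, Finsupp.prod, mul_pow,
    Finset.prod_mul_distrib, Finset.prod_pow_eq_pow_sum, Finsupp.degree_apply, mul_assoc,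
    Polynomial.algebraMap_eq]

theorem coeff_restrictToLine {σ k : Type*} [CommSemiring k] (v : σ → k) (n : ℕ)
    (f : MvPolynomial σ k) :
    (restrictToLine v f).coeff n = eval v (homogeneousComponent n f) := by
  induction f using MvPolynomial.induction_on' with
  | monomial s a =>
    rw [restrictToLine_monomial, Polynomial.coeff_C_mul, Polynomial.coeff_X_pow]
    by_cases h : s.degree = n
    · rw [homogeneousComponent_of_mem (isHomogeneous_monomial a h)]
      simp [h]
    · rw [homogeneousComponent_of_mem (isHomogeneous_monomial a rfl)]
      simp [Ne.symm h]
  | add p q hp hq => simp [hp, hq]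

theorem sub_aeval_restrictToLine_mem {k : Type*} [Field k] (v : Fin 2 → k) (α β : k)
    (h : α * v 0 + β * v 1 = 1) (g : MvPolynomial (Fin 2) k) :
    g - Polynomial.aeval (C α * X 0 + C β * X 1) (restrictToLine v g) ∈
      Ideal.span {C (v 1) * X 0 - C (v 0) * X 1} := by
  set ℓ : MvPolynomial (Fin 2) k := C (v 1) * X 0 - C (v 0) * X 1 with hℓ
  have hC : C (σ := Fin 2) α * C (v 0) + C β * C (v 1) = 1 := by
    rw [← C_mul, ← C_mul, ← C_add, h, C_1]
  rw [← Ideal.Quotient.eq]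
  suffices H : Ideal.Quotient.mkₐ k (Ideal.span {ℓ}) = (Ideal.Quotient.mkₐ k (Ideal.span {ℓ})).comp
      ((Polynomial.aeval (C α * X 0 + C β * X 1)).comp (restrictToLine v)) from
    DFunLike.congr_fun H g
  ext i
  simp only [AlgHom.comp_apply, Ideal.Quotient.mkₐ_eq_mk]
  rw [Ideal.Quotient.eq, Ideal.mem_span_singleton]
  fin_cases i
  · refine ⟨C β, ?_⟩
    simp only [restrictToLine, aeval_X, map_mul, Polynomial.aeval_C, Polynomial.aeval_X, hℓ,
      MvPolynomial.algebraMap_eq, Fin.zero_eta]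
    linear_combination (-X 0) * hC
  · refine ⟨-C α, ?_⟩
    simp only [restrictToLine, aeval_X, map_mul, Polynomial.aeval_C, Polynomial.aeval_X, hℓ,
      MvPolynomial.algebraMap_eq, Fin.mk_one]
    linear_combination (-X 1) * hC

theorem finite_quotient_of_span_X_pow_le {k : Type*} [Field k] {I : Ideal (MvPolynomial (Fin 2) k)}
    {r : ℕ} (h : (Ideal.span {X 0, X 1} : Ideal (MvPolynomial (Fin 2) k)) ^ r ≤ I) :
    Module.Finite k (MvPolynomial (Fin 2) k ⧸ I) := by
  have hX : ∀ i : Fin 2, IsIntegral k (Ideal.Quotient.mkₐ k I (X i)) := fun i => by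
    refine IsIntegral.of_pow (n := r + 1) r.succ_pos ?_
    have : Ideal.Quotient.mkₐ k I (X i) ^ (r + 1) = 0 := by
      rw [← map_pow, Ideal.Quotient.mkₐ_eq_mk, Ideal.Quotient.eq_zero_iff_mem, pow_succ]
      exact I.mul_mem_right _ (h (Ideal.pow_mem_pow (Ideal.subset_span (by fin_cases i <;> simp)) r))
    rw [this]
    exact isIntegral_zero
  have : Algebra.IsIntegral k (MvPolynomial (Fin 2) k ⧸ I) := by
    refine ⟨fun a => ?_⟩
    obtain ⟨g, rfl⟩ := Ideal.Quotient.mk_surjective a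
    induction g using MvPolynomial.induction_on with
    | C a => exact isIntegral_algebraMap (R := k) (x := a)
    | add p q hp hq => rw [map_add]; exact hp.add hq
    | mul_X p i hp => rw [map_mul]; exact hp.mul (hX i)
  exact Algebra.IsIntegral.finite

theorem isUnit_aeval_of_isNilpotent {k A : Type*} [Field k] [CommRing A] [Algebra k A] {u : A}
    (hu : IsNilpotent u) {w : Polynomial k} (hw : w.coeff 0 ≠ 0) :
    IsUnit (Polynomial.aeval u w) := by
  rw [← Polynomial.divX_mul_X_add w, map_add, map_mul, Polynomial.aeval_X, Polynomial.aeval_C]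
  exact IsNilpotent.isUnit_add_right_of_commute ((Commute.all _ _).isNilpotent_mul_left hu)
    ((IsUnit.mk0 _ hw).map (algebraMap k A)) (Commute.all _ _)

theorem finrank_socle_le_of_homogeneousComponent_ne_zero {k : Type*} [Field k] [Infinite k]
    {I : Ideal (MvPolynomial (Fin 2) k)} {r : ℕ}
    (hmI : (Ideal.span {X 0, X 1} : Ideal (MvPolynomial (Fin 2) k)) ^ r ≤ I)
    {d : ℕ} (hd : d ≠ 0) {f : MvPolynomial (Fin 2) k} (hf : f ∈ I)
    (hlt : ∀ i < d, homogeneousComponent i f = 0) (hne : homogeneousComponent d f ≠ 0) :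
    Module.finrank k (socle I) ≤ d := by
  have := finite_quotient_of_span_X_pow_le hmI
  obtain ⟨v, hv⟩ : ∃ v, eval v (homogeneousComponent d f) ≠ 0 := by
    by_contra! H
    exact hne (MvPolynomial.funext fun v => by simp [H v])
  obtain ⟨α, β, hαβ⟩ : ∃ α β, α * v 0 + β * v 1 = 1 := by
    by_cases h0 : v 0 = 0
    · by_cases h1 : v 1 = 0
      · have hv0 : v = 0 := by ext i; fin_cases i <;> simp [h0, h1]
        refine absurd ?_ hv
        rw [hv0, eval_zero, constantCoeff_eq, coeff_homogeneousComponent,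
          if_neg (by simpa using hd.symm)]
      · exact ⟨0, (v 1)⁻¹, by simp [h1]⟩
    · exact ⟨(v 0)⁻¹, 0, by simp [h0]⟩
  set ℓ : MvPolynomial (Fin 2) k ⧸ I := Ideal.Quotient.mk I (C (v 1) * X 0 - C (v 0) * X 1) with hℓ
  set u : MvPolynomial (Fin 2) k ⧸ I := Ideal.Quotient.mk I (C α * X 0 + C β * X 1) with hu
  have hnil : IsNilpotent u := by
    refine ⟨r, ?_⟩
    rw [hu, ← map_pow, Ideal.Quotient.eq_zero_iff_mem]
    exact hmI (Ideal.pow_mem_pow (Ideal.add_mem _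
      (Ideal.mul_mem_left _ _ (Ideal.subset_span (by simp)))
      (Ideal.mul_mem_left _ _ (Ideal.subset_span (by simp)))) r)
  have hmod : ∀ g, ℓ ∣ Ideal.Quotient.mk I g - Polynomial.aeval u (restrictToLine v g) := fun g => by
    have H := map_dvd (Ideal.Quotient.mk I)
      (Ideal.mem_span_singleton.1 (sub_aeval_restrictToLine_mem v α β hαβ g))
    rwa [map_sub _ g, ← Ideal.Quotient.mkₐ_eq_mk k I, ← Polynomial.aeval_algHom_apply] at H
  have hud : ℓ ∣ u ^ d := by
    obtain ⟨w, hw⟩ : Polynomial.X ^ d ∣ restrictToLine v f :=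
      Polynomial.X_pow_dvd_iff.2 fun i hi => by rw [coeff_restrictToLine, hlt i hi, map_zero]
    have hw0 : w.coeff 0 ≠ 0 := by
      rwa [← coeff_restrictToLine, hw, Polynomial.coeff_X_pow_mul', if_pos le_rfl,
        Nat.sub_self] at hv
    have H := hmod f
    rw [Ideal.Quotient.eq_zero_iff_mem.2 hf, zero_sub] at H
    replace H := (dvd_neg (α := MvPolynomial (Fin 2) k ⧸ I)).1 H
    rw [hw, map_mul, map_pow, Polynomial.aeval_X] at H
    exact (isUnit_aeval_of_isNilpotent hnil hw0).dvd_mul_right.1 H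
  have htop : LinearMap.range (LinearMap.mulLeft k ℓ) ⊔
      Submodule.span k (Set.range fun i : Fin d => u ^ (i : ℕ)) = ⊤ := by
    refine eq_top_iff.2 fun a _ => ?_
    obtain ⟨g, rfl⟩ := Ideal.Quotient.mk_surjective a
    set q := restrictToLine v g
    have hmem : ∀ b, ℓ ∣ b → b ∈ LinearMap.range (LinearMap.mulLeft k ℓ) := by
      rintro _ ⟨b, rfl⟩; exact ⟨b, rfl⟩
    have hq : Polynomial.aeval u (q %ₘ Polynomial.X ^ d) ∈
        Submodule.span k (Set.range fun i : Fin d => u ^ (i : ℕ)) := by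
      have hdeg : (q %ₘ Polynomial.X ^ d).natDegree < d := by
        have := Polynomial.natDegree_modByMonic_lt q (Polynomial.monic_X_pow (R := k) d)
          (fun h => hd (by simpa using congrArg Polynomial.natDegree h))
        simpa using this
      rw [Polynomial.aeval_eq_sum_range' hdeg]
      exact Submodule.sum_mem _ fun i hi => Submodule.smul_mem _ _
        (Submodule.subset_span ⟨⟨i, Finset.mem_range.1 hi⟩, rfl⟩)
    rw [← sub_add_cancel (Ideal.Quotient.mk I g) (Polynomial.aeval u (q %ₘ Polynomial.X ^ d))]
    refine Submodule.add_mem_sup (hmem _ ?_) hq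
    have H := congrArg (Polynomial.aeval u) (Polynomial.modByMonic_add_div q (Polynomial.X ^ d))
    rw [map_add, map_mul, map_pow, Polynomial.aeval_X] at H
    have : Ideal.Quotient.mk I g - Polynomial.aeval u (q %ₘ Polynomial.X ^ d) =
        (Ideal.Quotient.mk I g - Polynomial.aeval u q) +
          u ^ d * Polynomial.aeval u (q /ₘ Polynomial.X ^ d) := by
      rw [← H]; ring
    rw [this]
    exact dvd_add (hmod g) (hud.mul_right _)
  have hsocle : socle I ≤ LinearMap.ker (LinearMap.mulLeft k ℓ) := fun a ha => by
    have h0 : Ideal.Quotient.mk I (X 0) * a = 0 := ha.1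
    have h1 : Ideal.Quotient.mk I (X 1) * a = 0 := ha.2
    rw [LinearMap.mem_ker, LinearMap.mulLeft_apply, hℓ, map_sub, map_mul, map_mul]
    linear_combination Ideal.Quotient.mk I (C (v 1)) * h0 - Ideal.Quotient.mk I (C (v 0)) * h1
  have h1 := Submodule.finrank_mono hsocle
  have h2 := LinearMap.finrank_range_add_finrank_ker (LinearMap.mulLeft k ℓ)
  have h3 := Submodule.finrank_add_le_finrank_add_finrank (LinearMap.range (LinearMap.mulLeft k ℓ))
    (Submodule.span k (Set.range fun i : Fin d => u ^ (i : ℕ)))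
  have h4 := finrank_range_le_card (R := k) (fun i : Fin d => u ^ (i : ℕ))
  rw [htop, finrank_top] at h3
  rw [Fintype.card_fin, Set.finrank] at h4
  omega

theorem triangle_le_finrank_quotient {k : Type*} [Field k] {I : Ideal (MvPolynomial (Fin 2) k)}
    [Module.Finite k (MvPolynomial (Fin 2) k ⧸ I)] {d : ℕ}
    (h : ∀ f ∈ I, ∀ i < d, homogeneousComponent i f = 0) :
    d * (d + 1) ≤ 2 * Module.finrank k (MvPolynomial (Fin 2) k ⧸ I) := by
  let e : (Σ i : Fin d, Fin (i + 1)) → (Fin 2 →₀ ℕ) := fun p =>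
    Finsupp.single 0 (p.2 : ℕ) + Finsupp.single 1 (p.1 - p.2 : ℕ)
  have hdeg : ∀ p, (e p).degree = p.1 := fun p => by
    have := p.2.2
    simp only [e, map_add, Finsupp.degree_single]
    omega
  have he : Function.Injective e := by
    rintro p q hpq
    have h1 : (p.1 : ℕ) = q.1 := by rw [← hdeg p, ← hdeg q, hpq]
    have h2 : (p.2 : ℕ) = q.2 := by simpa [e] using DFunLike.congr_fun hpq 0
    obtain ⟨i, j⟩ := p
    obtain ⟨i', j'⟩ := q
    obtain rfl : i = i' := Fin.ext h1
    obtain rfl : j = j' := Fin.ext h2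
    rfl
  have hli : LinearIndependent k fun p => Ideal.Quotient.mk I (monomial (e p) 1) := by
    rw [Fintype.linearIndependent_iff]
    intro c hc p
    have hmem : ∑ q, monomial (e q) (c q) ∈ I := by
      rw [← Ideal.Quotient.eq_zero_iff_mem, map_sum, ← hc]
      refine Finset.sum_congr rfl fun q _ => ?_
      rw [← mul_one (c q), ← smul_eq_mul, ← smul_monomial, smul_eq_mul, mul_one]
      exact map_smul (Ideal.Quotient.mkₐ k I) _ _
    have H := congrArg (coeff (e p)) (h _ hmem p.1 p.1.2)
    rw [coeff_homogeneousComponent, if_pos (hdeg p), coeff_sum, coeff_zero,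
      Finset.sum_eq_single p] at H
    · simpa using H
    · intro q _ hq
      rw [coeff_monomial, if_neg (he.ne hq)]
    · simp
  have hcard := hli.fintype_card_le_finrank
  rw [Fintype.card_sigma] at hcard
  simp only [Fintype.card_fin] at hcard
  rw [Fin.sum_univ_eq_sum_range (fun i => i + 1) d] at hcard
  have hsum := Finset.sum_range_id_mul_two (d + 1)
  rw [Finset.sum_range_succ', add_zero, Nat.add_sub_cancel] at hsum
  linarith

/-- Theorem 1.2: for an `m`-primary ideal `I ⊆ k[X,Y]` of colength `n`,
the socle dimension `b₂` satisfies `b₂ ≤ ⌊(√(8n+1) − 1)/2⌋`. -/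
theorem socle_dim_le_sqrt_bound {k : Type*} [Field k] [IsAlgClosed k] [CharZero k]
    (I : Ideal (MvPolynomial (Fin 2) k)) (r : ℕ) (hr : 1 ≤ r)
    (hmI : (Ideal.span {X 0, X 1} : Ideal (MvPolynomial (Fin 2) k)) ^ r ≤ I)
    (hIm : I ≤ Ideal.span {X 0, X 1}) :
    Module.finrank k ↥(socle I) ≤
      (Nat.sqrt (8 * Module.finrank k (MvPolynomial (Fin 2) k ⧸ I) + 1) - 1) / 2 := by
  classical
  have := finite_quotient_of_span_X_pow_le hmI
  have hex : ∃ d, ∃ f ∈ I, homogeneousComponent d f ≠ 0 := by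
    refine ⟨r, X 0 ^ r, hmI (Ideal.pow_mem_pow (Ideal.subset_span (by simp)) r), ?_⟩
    rw [homogeneousComponent_of_mem (isHomogeneous_X_pow 0 r), if_pos rfl]
    exact pow_ne_zero _ (X_ne_zero 0)
  have hlt : ∀ f ∈ I, ∀ i < Nat.find hex, homogeneousComponent i f = 0 := fun f hf i hi => by
    by_contra H
    exact Nat.find_min hex hi ⟨f, hf, H⟩
  obtain ⟨f, hf, hne⟩ := Nat.find_spec hex
  have hd : Nat.find hex ≠ 0 := fun h0 => by
    rw [h0, homogeneousComponent_zero] at hne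
    refine hne ?_
    have hker : Ideal.span {X 0, X 1} ≤ RingHom.ker (constantCoeff (σ := Fin 2) (R := k)) := by
      rw [Ideal.span_le]
      rintro _ (rfl | rfl) <;> simp
    rw [← constantCoeff_eq, RingHom.mem_ker.1 (hker (hIm hf)), C_0]
  have hb := finrank_socle_le_of_homogeneousComponent_ne_zero hmI hd hf (hlt f hf) hne
  have hn := triangle_le_finrank_quotient hlt
  have hsqrt : 2 * Module.finrank k (socle I) + 1 ≤
      Nat.sqrt (8 * Module.finrank k (MvPolynomial (Fin 2) k ⧸ I) + 1) := by
    rw [Nat.le_sqrt]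
    nlinarith [Nat.mul_le_mul hb (Nat.succ_le_succ hb)]
  omega
end

section
/- Let k be an algebraically closed field of characteristic 0, R = k[X,Y], m = (X,Y), and let I be a proper ideal with m^r ⊆ I ⊆ m for some r ≥ 1. Set n = dim_k (R/I) and b₂ = dim_k Soc(R/I), where Soc(R/I) = {a ∈ R/I : X·a = 0 and Y·a = 0}. Then b₂(b₂+1)/2 ≤ n, i.e. the binomial coefficient C(b₂+1, 2) is at most n. -/
open MvPolynomial

theorem isIntegral_quotient_of_pow_le {k : Type*} [Field k]
    (I : Ideal (MvPolynomial (Fin 2) k)) (r : ℕ)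
    (hmI : (Ideal.span {X 0, X 1} : Ideal (MvPolynomial (Fin 2) k)) ^ r ≤ I) :
    Algebra.IsIntegral k (MvPolynomial (Fin 2) k ⧸ I) := by
  have hX (i : Fin 2) :
      IsIntegral k (Ideal.Quotient.mkₐ k I (X i : MvPolynomial (Fin 2) k)) := by
    refine ⟨Polynomial.X ^ r, Polynomial.monic_X_pow r, ?_⟩
    rw [Polynomial.eval₂_pow, Polynomial.eval₂_X, ← map_pow]
    refine Ideal.Quotient.eq_zero_iff_mem.mpr (hmI (Ideal.pow_mem_pow ?_ r))
    fin_cases i <;> exact Ideal.subset_span (by simp)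
  refine ⟨fun x ↦ ?_⟩
  obtain ⟨p, rfl⟩ := Ideal.Quotient.mkₐ_surjective k I x
  induction p using MvPolynomial.induction_on with
  | C a => exact (isIntegral_algebraMap (A := MvPolynomial (Fin 2) k)).map _
  | add p q hp hq => rw [map_add]; exact hp.add hq
  | mul_X p i hp => rw [map_mul]; exact hp.mul (hX i)

theorem finite_quotient_of_pow_le {k : Type*} [Field k]
    (I : Ideal (MvPolynomial (Fin 2) k)) (r : ℕ)
    (hmI : (Ideal.span {X 0, X 1} : Ideal (MvPolynomial (Fin 2) k)) ^ r ≤ I) :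
    Module.Finite k (MvPolynomial (Fin 2) k ⧸ I) :=
  have := isIntegral_quotient_of_pow_le I r hmI
  Algebra.IsIntegral.finite

/-- The kernel and the cokernel of an endomorphism of a finite-dimensional space have the same
dimension, so an ideal-theoretic cokernel bounds any subspace killed by `l`. -/
theorem finrank_le_finrank_quotient_span_singleton {k A : Type*} [Field k] [CommRing A]
    [Algebra k A] [Module.Finite k A] (l : A) (V : Submodule k A)
    (hV : V ≤ LinearMap.ker (LinearMap.mulLeft k l)) :
    Module.finrank k V ≤ Module.finrank k (A ⧸ Ideal.span {l}) := by
  have hker : LinearMap.ker (Ideal.Quotient.mkₐ k (Ideal.span {l})).toLinearMap =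
      LinearMap.range (LinearMap.mulLeft k l) := by
    ext x
    rw [LinearMap.mem_ker, AlgHom.toLinearMap_apply, Ideal.Quotient.mkₐ_eq_mk,
      Ideal.Quotient.eq_zero_iff_mem, Ideal.mem_span_singleton', LinearMap.mem_range]
    simp [mul_comm]
  have h₁ := LinearMap.finrank_range_add_finrank_ker (LinearMap.mulLeft k l)
  have h₂ := LinearMap.finrank_range_add_finrank_ker
    (Ideal.Quotient.mkₐ k (Ideal.span {l})).toLinearMap
  rw [hker, LinearMap.range_eq_top.mpr (Ideal.Quotient.mkₐ_surjective k _), finrank_top] at h₂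
  have h₃ := Submodule.finrank_mono hV
  omega

/-- Restriction of a polynomial in two variables to the line of slope `c` through the origin. -/
noncomputable def restrictLine {k : Type*} [Field k] (c : k) :
    MvPolynomial (Fin 2) k →ₐ[k] Polynomial k :=
  aeval ![Polynomial.X, Polynomial.C c * Polynomial.X]

theorem coeff_restrictLine {k : Type*} [Field k] (c : k) (f : MvPolynomial (Fin 2) k) (i : ℕ) :
    (restrictLine c f).coeff i = eval ![1, c] (homogeneousComponent i f) := by
  induction f using MvPolynomial.induction_on' with
  | add p q hp hq => simp [hp, hq]
  | monomial d a =>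
    have hd : d.degree = d 0 + d 1 := by simp [Finsupp.degree_eq_sum]
    have hl : restrictLine c (monomial d a) =
        Polynomial.C (a * c ^ d 1) * Polynomial.X ^ (d 0 + d 1) := by
      simp only [restrictLine, aeval_monomial, Polynomial.algebraMap_eq]
      rw [Finsupp.prod_fintype _ _ (by simp)]
      simp [Fin.prod_univ_two, mul_pow]
      ring
    rw [hl, Polynomial.coeff_C_mul_X_pow]
    split_ifs with h
    · rw [homogeneousComponent_of_mem (isHomogeneous_monomial a hd), if_pos h, eval_monomial,
        Finsupp.prod_fintype _ _ (by simp)]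
      simp [Fin.prod_univ_two]
    · rw [homogeneousComponent_of_mem (isHomogeneous_monomial a hd), if_neg h, map_zero]

theorem X_pow_dvd_restrictLine {k : Type*} [Field k]
    (I : Ideal (MvPolynomial (Fin 2) k)) (r : ℕ)
    (hmI : (Ideal.span {X 0, X 1} : Ideal (MvPolynomial (Fin 2) k)) ^ r ≤ I)
    (c : k) {f : MvPolynomial (Fin 2) k} (hf : f ∈ I) :
    Polynomial.X ^ Module.finrank k (socle I) ∣ restrictLine c f := by
  have := finite_quotient_of_pow_le I r hmI
  set l : MvPolynomial (Fin 2) k ⧸ I := Ideal.Quotient.mk I (C c * X 0 - X 1) with hl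
  let π : MvPolynomial (Fin 2) k →ₐ[k] (MvPolynomial (Fin 2) k ⧸ I) ⧸ Ideal.span {l} :=
    (Ideal.Quotient.mkₐ k (Ideal.span {l})).comp (Ideal.Quotient.mkₐ k I)
  have hπ : Function.Surjective π :=
    (Ideal.Quotient.mkₐ_surjective k _).comp (Ideal.Quotient.mkₐ_surjective k I)
  have hπI {g : MvPolynomial (Fin 2) k} (hg : g ∈ I) : π g = 0 := by
    change Ideal.Quotient.mkₐ k (Ideal.span {l}) (Ideal.Quotient.mk I g) = 0
    rw [Ideal.Quotient.eq_zero_iff_mem.mpr hg, map_zero]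
  have hπl : π (C c * X 0 - X 1) = 0 :=
    Ideal.Quotient.eq_zero_iff_mem.mpr (Ideal.mem_span_singleton_self l)
  let ψ := Polynomial.aeval (R := k) (π (X 0))
  have hψ : ψ.comp (restrictLine c) = π := by
    refine MvPolynomial.algHom_ext fun i ↦ ?_
    fin_cases i
    · simp [ψ, restrictLine]
    · rw [map_sub, map_mul, sub_eq_zero] at hπl
      simpa [ψ, restrictLine] using hπl
  have hψs : Function.Surjective ψ := fun y ↦ by
    obtain ⟨g, rfl⟩ := hπ y
    exact ⟨restrictLine c g, DFunLike.congr_fun hψ g⟩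
  have hsoc : socle I ≤ LinearMap.ker (LinearMap.mulLeft k l) := by
    rintro x ⟨h0, h1⟩
    simp only [SetLike.mem_coe, LinearMap.mem_ker, LinearMap.mulLeft_apply] at h0 h1 ⊢
    rw [hl, map_sub, map_mul, sub_mul, mul_assoc, h0, h1, mul_zero, sub_zero]
  have hle := finrank_le_finrank_quotient_span_singleton l _ hsoc
  obtain ⟨p, hp⟩ := (IsPrincipalIdealRing.principal (RingHom.ker ψ)).principal
  rw [Ideal.submodule_span_eq] at hp
  have hrank : Module.finrank k ((MvPolynomial (Fin 2) k ⧸ I) ⧸ Ideal.span {l}) =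
      p.natDegree := by
    rw [← (Ideal.quotientKerAlgEquivOfSurjective hψs).toLinearEquiv.finrank_eq,
      (Ideal.quotientEquivAlgOfEq k hp).toLinearEquiv.finrank_eq, finrank_quotient_span_eq_natDegree]
  have hmem {q : Polynomial k} (hq : ψ q = 0) : p ∣ q := by
    rwa [← Ideal.mem_span_singleton, ← hp, RingHom.mem_ker]
  have hpr : p ∣ Polynomial.X ^ r := hmem <| by
    rw [map_pow, Polynomial.aeval_X, ← map_pow]
    exact hπI (hmI (Ideal.pow_mem_pow (Ideal.subset_span (by simp)) r))
  have hpf : p ∣ restrictLine c f := hmem ((DFunLike.congr_fun hψ f).trans (hπI hf))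
  obtain ⟨j, -, hj⟩ := (dvd_prime_pow Polynomial.prime_X r).mp hpr
  have hpj : p.natDegree = j := by
    rw [Polynomial.natDegree_eq_of_degree_eq (Polynomial.degree_eq_degree_of_associated hj),
      Polynomial.natDegree_X_pow]
  exact (pow_dvd_pow _ (by omega)).trans (hj.symm.dvd.trans hpf)

theorem eval_smul_of_isHomogeneous {σ k : Type*} [CommSemiring k] [Fintype σ]
    {p : MvPolynomial σ k} {n : ℕ} (hp : p.IsHomogeneous n) (t : k) (v : σ → k) :
    eval (t • v) p = t ^ n * eval v p := by
  rw [eval_eq', eval_eq', Finset.mul_sum]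
  refine Finset.sum_congr rfl fun d hd ↦ ?_
  have hdeg : ∑ i, d i = n := by
    rw [← Finsupp.degree_eq_sum, hp.degree_eq_sum_deg_support hd, Finsupp.degree_apply]
  simp only [Pi.smul_apply, smul_eq_mul, mul_pow, Finset.prod_mul_distrib,
    Finset.prod_pow_eq_pow_sum, hdeg]
  ring

theorem homogeneousComponent_eq_zero_of_mem {k : Type*} [Field k] [Infinite k]
    (I : Ideal (MvPolynomial (Fin 2) k)) (r : ℕ)
    (hmI : (Ideal.span {X 0, X 1} : Ideal (MvPolynomial (Fin 2) k)) ^ r ≤ I)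
    {f : MvPolynomial (Fin 2) k} (hf : f ∈ I) {i : ℕ} (hi : i < Module.finrank k (socle I)) :
    homogeneousComponent i f = 0 := by
  have hline (c : k) : eval ![1, c] (homogeneousComponent i f) = 0 := by
    rw [← coeff_restrictLine]
    exact Polynomial.X_pow_dvd_iff.mp (X_pow_dvd_restrictLine I r hmI c hf) i hi
  have hmul : homogeneousComponent i f * X 0 = 0 := by
    refine MvPolynomial.funext fun v ↦ ?_
    rw [map_mul, eval_X, map_zero]
    by_cases hv : v 0 = 0
    · rw [hv, mul_zero]
    · have hscale : v = v 0 • ![1, v 1 / v 0] := by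
        ext j
        fin_cases j
        · simp
        · simp [mul_div_cancel₀ _ hv]
      have := eval_smul_of_isHomogeneous (homogeneousComponent_isHomogeneous i f)
        (v 0) ![1, v 1 / v 0]
      rw [hscale, this, hline]
      simp
  exact (mul_eq_zero.mp hmul).resolve_right (X_ne_zero 0)

/-- An ideal whose elements all have order at least `b` has colength at least that of `m ^ b`. -/
theorem choose_succ_two_le_finrank_quotient {k : Type*} [Field k]
    (I : Ideal (MvPolynomial (Fin 2) k)) [Module.Finite k (MvPolynomial (Fin 2) k ⧸ I)] (b : ℕ)
    (h : ∀ f ∈ I, ∀ i < b, homogeneousComponent i f = 0) :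
    (b + 1).choose 2 ≤ Module.finrank k (MvPolynomial (Fin 2) k ⧸ I) := by
  let e : (Σ i : Fin b, Fin (i + 1)) → (Fin 2 →₀ ℕ) :=
    fun p ↦ Finsupp.equivFunOnFinite.symm ![p.1 - p.2, p.2]
  have hdeg (p) : (e p).degree = p.1 := by
    have := p.2.is_lt
    simp [e, Finsupp.degree_eq_sum]
    omega
  have he : Function.Injective e := by
    rintro ⟨i, j⟩ ⟨i', j'⟩ hij
    have hi : i = i' := Fin.ext (by simpa [hdeg] using congrArg Finsupp.degree hij)
    subst hi
    have hj : j = j' := Fin.ext (by simpa [e] using DFunLike.congr_fun hij 1)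
    rw [hj]
  let T : MvPolynomial (Fin 2) k →ₗ[k] ((Σ i : Fin b, Fin (i + 1)) → k) :=
    LinearMap.pi fun p ↦ lcoeff k (e p)
  have hT : I.restrictScalars k ≤ LinearMap.ker T := fun f hf ↦ by
    ext p
    have := congrArg (coeff (e p)) (h f hf p.1 p.1.is_lt)
    rw [coeff_homogeneousComponent, if_pos (hdeg p)] at this
    simpa [T] using this
  have hTs : Function.Surjective T := fun v ↦ by
    refine ⟨∑ p, monomial (e p) (v p), ?_⟩
    ext q
    simp [T, coeff_monomial, he.eq_iff]
  let T' : (MvPolynomial (Fin 2) k ⧸ I) →ₗ[k] ((Σ i : Fin b, Fin (i + 1)) → k) :=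
    (I.restrictScalars k).liftQ T hT
  have hTs' : Function.Surjective T' := fun v ↦ by
    obtain ⟨f, rfl⟩ := hTs v
    exact ⟨Ideal.Quotient.mk I f, rfl⟩
  have hle := LinearMap.finrank_le_finrank_of_surjective hTs'
  rw [Module.finrank_fintype_fun_eq_card, Fintype.card_sigma] at hle
  simp only [Fintype.card_fin] at hle
  rw [Fin.sum_univ_eq_sum_range (fun i ↦ i + 1) b] at hle
  rwa [Nat.choose_two_right, ← Finset.sum_range_id, Finset.sum_range_succ', add_zero]

/-- For an `m`-primary ideal `I ⊆ k[X,Y]` of colength `n = dim_k R/I` and socle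
dimension `b₂`, one has `C(b₂ + 1, 2) = b₂(b₂+1)/2 ≤ n`. -/
theorem choose_socle_dim_succ_two_le {k : Type*} [Field k] [IsAlgClosed k] [CharZero k]
    (I : Ideal (MvPolynomial (Fin 2) k)) (r : ℕ) (hr : 1 ≤ r)
    (hmI : (Ideal.span {X 0, X 1} : Ideal (MvPolynomial (Fin 2) k)) ^ r ≤ I)
    (hIm : I ≤ Ideal.span {X 0, X 1}) :
    Nat.choose (Module.finrank k ↥(socle I) + 1) 2 ≤
      Module.finrank k (MvPolynomial (Fin 2) k ⧸ I) := by
  have := finite_quotient_of_pow_le I r hmI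
  exact choose_succ_two_le_finrank_quotient I _ fun f hf i hi ↦
    homogeneousComponent_eq_zero_of_mem I r hmI hf hi
end

section
/- Let k be an algebraically closed field of characteristic 0 and n ≥ 1 a natural number. Then there exists a proper ideal I of R = k[X,Y] with m^r ⊆ I ⊆ m for some r ≥ 1 (m = (X,Y)), such that dim_k (R/I) = n and dim_k Soc(R/I) = ⌊(√(8n+1) − 1)/2⌋, where Soc(R/I) = {a ∈ R/I : X·a = 0 and Y·a = 0}. In particular, the bound b₂ ≤ ⌊(√(8n+1) − 1)/2⌋ is optimal. -/
open MvPolynomial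

section Staircase

variable {k : Type*} [Field k] {σ : Type*}

theorem mem_restrictSupportIdeal_compl_iff {D : Finset (σ →₀ ℕ)}
    (hD : IsUpperSet (D : Set (σ →₀ ℕ))ᶜ) {p : MvPolynomial σ k} :
    p ∈ restrictSupportIdeal (R := k) _ hD ↔ ∀ d ∈ D, coeff d p = 0 := by
  change (p.support : Set (σ →₀ ℕ)) ⊆ (D : Set (σ →₀ ℕ))ᶜ ↔ _
  simp only [Set.subset_def, Finset.mem_coe, mem_support_iff, Set.mem_compl_iff]
  exact forall_congr' fun d => by tauto

theorem linearIndependent_mk_monomial {D T : Finset (σ →₀ ℕ)}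
    (hD : IsUpperSet (D : Set (σ →₀ ℕ))ᶜ) (hT : T ⊆ D) :
    LinearIndependent k fun d : T =>
      Ideal.Quotient.mk (restrictSupportIdeal (R := k) _ hD) (monomial (d : σ →₀ ℕ) 1) := by
  classical
  rw [Fintype.linearIndependent_iff]
  intro g hg i
  have h : Ideal.Quotient.mk (restrictSupportIdeal (R := k) _ hD)
      (∑ j : T, g j • monomial (j : σ →₀ ℕ) 1) = 0 := by
    rw [← hg, map_sum]
    rfl
  rw [Ideal.Quotient.eq_zero_iff_mem, mem_restrictSupportIdeal_compl_iff] at h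
  simpa [coeff_sum, coeff_monomial, Subtype.coe_inj] using h i (hT i.2)

theorem mk_mem_span_monomial {D T : Finset (σ →₀ ℕ)}
    (hD : IsUpperSet (D : Set (σ →₀ ℕ))ᶜ) {p : MvPolynomial σ k}
    (hp : ∀ d ∈ D, d ∉ T → coeff d p = 0) :
    Ideal.Quotient.mk (restrictSupportIdeal (R := k) _ hD) p ∈
      Submodule.span k (Set.range fun d : T =>
        Ideal.Quotient.mk (restrictSupportIdeal (R := k) _ hD) (monomial (d : σ →₀ ℕ) 1)) := by
  classical
  have h : Ideal.Quotient.mk (restrictSupportIdeal (R := k) _ hD) p =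
      Ideal.Quotient.mk (restrictSupportIdeal (R := k) _ hD)
        (∑ d : T, coeff (d : σ →₀ ℕ) p • monomial (d : σ →₀ ℕ) 1) := by
    rw [Ideal.Quotient.eq, mem_restrictSupportIdeal_compl_iff]
    intro d hd
    rw [Finset.sum_coe_sort T fun d => coeff d p • monomial d (1 : k)]
    by_cases hdT : d ∈ T
    · simp [coeff_sum, coeff_monomial, hdT]
    · simp [coeff_sum, coeff_monomial, hdT, hp d hd hdT]
  rw [h, map_sum]
  exact Submodule.sum_mem _ fun d _ =>
    Submodule.smul_mem _ (coeff (d : σ →₀ ℕ) p) (Submodule.subset_span (Set.mem_range_self d))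

/-- The colength of the monomial ideal with finite staircase `D` is the size of `D`. -/
theorem finrank_quotient_restrictSupportIdeal_compl {D : Finset (σ →₀ ℕ)}
    (hD : IsUpperSet (D : Set (σ →₀ ℕ))ᶜ) :
    Module.finrank k (MvPolynomial σ k ⧸ restrictSupportIdeal (R := k) _ hD) = D.card := by
  have h := finrank_span_eq_card (linearIndependent_mk_monomial (k := k) hD subset_rfl)
  rw [Fintype.card_coe] at h
  have : Submodule.span k (Set.range fun d : D =>
        Ideal.Quotient.mk (restrictSupportIdeal (R := k) _ hD) (monomial (d : σ →₀ ℕ) 1)) = ⊤ := by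
    rw [eq_top_iff]
    rintro x -
    obtain ⟨p, rfl⟩ := Ideal.Quotient.mk_surjective x
    exact mk_mem_span_monomial hD fun d hd hd' => absurd hd hd'
  rwa [this, finrank_top] at h

theorem X_mul_mem_restrictSupportIdeal_compl_iff {D : Finset (σ →₀ ℕ)}
    (hD : IsUpperSet (D : Set (σ →₀ ℕ))ᶜ) {p : MvPolynomial σ k} (i : σ) :
    X i * p ∈ restrictSupportIdeal (R := k) _ hD ↔
      ∀ d, d + Finsupp.single i 1 ∈ D → coeff d p = 0 := by
  classical
  rw [mem_restrictSupportIdeal_compl_iff]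
  constructor
  · intro h d hd
    have := h _ hd
    rwa [add_comm, coeff_X_mul] at this
  · intro h d hd
    rw [coeff_X_mul']
    split_ifs with hi
    · refine h _ ?_
      rwa [tsub_add_cancel_of_le]
      rw [Finsupp.single_le_iff]
      exact Nat.one_le_iff_ne_zero.mpr (Finsupp.mem_support_iff.mp hi)
    · rfl

theorem mk_mem_socle_iff {I : Ideal (MvPolynomial (Fin 2) k)} {p : MvPolynomial (Fin 2) k} :
    Ideal.Quotient.mk I p ∈ socle I ↔ X 0 * p ∈ I ∧ X 1 * p ∈ I := by
  simp only [socle, Submodule.mem_inf, LinearMap.mem_ker, LinearMap.mulLeft_apply, ← map_mul,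
    Ideal.Quotient.eq_zero_iff_mem]

/-- The socle of the monomial ideal with finite staircase `D` has dimension the number of
corners of `D`. -/
theorem finrank_socle_restrictSupportIdeal_compl {D C : Finset (Fin 2 →₀ ℕ)}
    (hD : IsUpperSet (D : Set (Fin 2 →₀ ℕ))ᶜ)
    (hC : ∀ d, d ∈ C ↔ d ∈ D ∧ d + Finsupp.single 0 1 ∉ D ∧ d + Finsupp.single 1 1 ∉ D) :
    Module.finrank k (socle (restrictSupportIdeal (R := k) _ hD)) = C.card := by
  classical
  have hCD : C ⊆ D := fun d hd => ((hC d).mp hd).1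
  have h := finrank_span_eq_card (linearIndependent_mk_monomial (k := k) hD hCD)
  rw [Fintype.card_coe] at h
  rw [← h]
  suffices socle (restrictSupportIdeal (R := k) _ hD) = Submodule.span k (Set.range fun d : C =>
      Ideal.Quotient.mk (restrictSupportIdeal (R := k) _ hD)
        (monomial (d : Fin 2 →₀ ℕ) 1)) by rw [this]
  apply le_antisymm
  · intro x hx
    obtain ⟨p, rfl⟩ := Ideal.Quotient.mk_surjective x
    rw [mk_mem_socle_iff, X_mul_mem_restrictSupportIdeal_compl_iff,
      X_mul_mem_restrictSupportIdeal_compl_iff] at hx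
    refine mk_mem_span_monomial hD fun d hd hdC => ?_
    by_cases h0 : d + Finsupp.single 0 1 ∈ D
    · exact hx.1 d h0
    · by_cases h1 : d + Finsupp.single 1 1 ∈ D
      · exact hx.2 d h1
      · exact absurd ((hC d).mpr ⟨hd, h0, h1⟩) hdC
  · rw [Submodule.span_le]
    rintro _ ⟨⟨c, hc⟩, rfl⟩
    obtain ⟨-, h0, h1⟩ := (hC c).mp hc
    simp only [SetLike.mem_coe]
    rw [mk_mem_socle_iff, X_mul_mem_restrictSupportIdeal_compl_iff,
      X_mul_mem_restrictSupportIdeal_compl_iff]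
    constructor <;> intro d hd <;> rw [coeff_monomial, if_neg] <;> rintro rfl <;> contradiction

theorem exists_pow_idealOfVars_le_restrictSupportIdeal_compl {D : Finset (σ →₀ ℕ)}
    (hD : IsUpperSet (D : Set (σ →₀ ℕ))ᶜ) :
    ∃ r, 1 ≤ r ∧ idealOfVars σ k ^ r ≤ restrictSupportIdeal (R := k) _ hD := by
  refine ⟨D.sup Finsupp.degree + 1, by omega, fun p hp => ?_⟩
  rw [mem_restrictSupportIdeal_compl_iff]
  rw [mem_pow_idealOfVars_iff'] at hp
  exact fun d hd => hp d (Nat.lt_succ_of_le (Finset.le_sup hd))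

theorem restrictSupportIdeal_compl_le_idealOfVars {D : Finset (σ →₀ ℕ)}
    (hD : IsUpperSet (D : Set (σ →₀ ℕ))ᶜ) (h0 : 0 ∈ D) :
    restrictSupportIdeal (R := k) _ hD ≤ idealOfVars σ k := by
  intro p hp
  rw [mem_restrictSupportIdeal_compl_iff] at hp
  rw [← pow_one (idealOfVars σ k), mem_pow_idealOfVars_iff']
  intro d hd
  rw [Nat.lt_one_iff, Finsupp.degree_eq_zero_iff] at hd
  exact hd ▸ hp 0 h0

end Staircase

theorem idealOfVars_fin_two (k : Type*) [Field k] :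
    idealOfVars (Fin 2) k = Ideal.span {X 0, X 1} := by
  rw [idealOfVars]
  congr 1
  ext p
  simp [Fin.exists_fin_two, eq_comm]

/-- The exponent `(i, j)` of the monomial `X ^ i * Y ^ j`. -/
noncomputable def exponent (i j : ℕ) : Fin 2 →₀ ℕ :=
  Finsupp.single 0 i + Finsupp.single 1 j

@[simp]
theorem exponent_zero (i j : ℕ) : exponent i j 0 = i := by
  simp [exponent]

@[simp]
theorem exponent_one (i j : ℕ) : exponent i j 1 = j := by
  simp [exponent]

theorem exponent_eq_iff {i j : ℕ} {d : Fin 2 →₀ ℕ} : exponent i j = d ↔ i = d 0 ∧ j = d 1 := by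
  simp [Finsupp.ext_iff, Fin.forall_fin_two]

/-- The staircase with `b` columns, the `i`-th of which has height `h i`. -/
noncomputable def staircase (b : ℕ) (h : ℕ → ℕ) : Finset (Fin 2 →₀ ℕ) :=
  ((Finset.range b).sigma fun i => Finset.range (h i)).image fun x => exponent x.1 x.2

theorem mem_staircase {b : ℕ} {h : ℕ → ℕ} {d : Fin 2 →₀ ℕ} :
    d ∈ staircase b h ↔ d 0 < b ∧ d 1 < h (d 0) := by
  simp only [staircase, Finset.mem_image, Finset.mem_sigma, Finset.mem_range, exponent_eq_iff]
  constructor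
  · rintro ⟨⟨i, j⟩, ⟨hi, hj⟩, rfl, rfl⟩
    exact ⟨hi, hj⟩
  · exact fun hd => ⟨⟨d 0, d 1⟩, hd, rfl, rfl⟩

theorem card_staircase (b : ℕ) (h : ℕ → ℕ) :
    (staircase b h).card = ∑ i ∈ Finset.range b, h i := by
  rw [staircase, Finset.card_image_of_injective, Finset.card_sigma]
  · simp
  · rintro ⟨i, j⟩ ⟨i', j'⟩ hij
    obtain ⟨h0, h1⟩ := exponent_eq_iff.mp hij
    simp_all

theorem isUpperSet_compl_staircase {b : ℕ} {h : ℕ → ℕ} (hh : Antitone h) :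
    IsUpperSet (staircase b h : Set (Fin 2 →₀ ℕ))ᶜ := by
  intro d e hde hd he
  refine hd ?_
  rw [Finset.mem_coe, mem_staircase] at he ⊢
  have := hh (hde 0)
  have := hde 0
  have := hde 1
  omega

theorem mem_corners_staircase_iff {b : ℕ} {h : ℕ → ℕ} (hpos : ∀ i < b, 0 < h i)
    (hh : ∀ i, i + 1 < b → h (i + 1) < h i) (d : Fin 2 →₀ ℕ) :
    d ∈ (Finset.range b).image (fun i => exponent i (h i - 1)) ↔
      d ∈ staircase b h ∧ d + Finsupp.single 0 1 ∉ staircase b h ∧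
        d + Finsupp.single 1 1 ∉ staircase b h := by
  simp only [mem_staircase, Finset.mem_image, Finset.mem_range, exponent_eq_iff]
  simp only [Finsupp.add_apply, Finsupp.single_apply]
  simp only [if_true, Fin.zero_eq_one_iff, Fin.one_eq_zero_iff, OfNat.ofNat_ne_one, if_false,
    add_zero]
  constructor
  · rintro ⟨i, hi, rfl, h1⟩
    have := hpos _ hi
    have := hh (d 0)
    omega
  · rintro ⟨⟨h0, h1⟩, -, h3⟩
    exact ⟨d 0, h0, rfl, by omega⟩

theorem two_mul_sum_range_sub (b : ℕ) :
    2 * ∑ i ∈ Finset.range b, (b - i) = b * (b + 1) := by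
  induction b with
  | zero => simp
  | succ b ih =>
    rw [Finset.sum_range_succ']
    simp only [Nat.add_sub_add_right, mul_add, ih]
    simp
    ring

/-- Optimality in Theorem 1.2: for every `n ≥ 1` there is an `m`-primary ideal
`I ⊆ k[X,Y]` of colength `n` with socle dimension exactly `⌊(√(8n+1) − 1)/2⌋`. -/
theorem exists_ideal_socle_dim_eq_sqrt_bound {k : Type*} [Field k] [IsAlgClosed k]
    [CharZero k] (n : ℕ) (hn : 1 ≤ n) :
    ∃ I : Ideal (MvPolynomial (Fin 2) k), ∃ r : ℕ, 1 ≤ r ∧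
      (Ideal.span {X 0, X 1} : Ideal (MvPolynomial (Fin 2) k)) ^ r ≤ I ∧
      I ≤ Ideal.span {X 0, X 1} ∧
      Module.finrank k (MvPolynomial (Fin 2) k ⧸ I) = n ∧
      Module.finrank k ↥(socle I) = (Nat.sqrt (8 * n + 1) - 1) / 2 := by
  set b := (Nat.sqrt (8 * n + 1) - 1) / 2 with hb
  have hs : 3 ≤ Nat.sqrt (8 * n + 1) := Nat.le_sqrt.mpr (by omega)
  have hb1 : 1 ≤ b := by omega
  have hbn : b * (b + 1) ≤ 2 * n := by
    have h1 : 2 * b + 1 ≤ Nat.sqrt (8 * n + 1) := by omega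
    have h2 := Nat.le_sqrt.mp h1
    nlinarith
  have hsum := two_mul_sum_range_sub b
  set e := n - ∑ i ∈ Finset.range b, (b - i) with he
  let h : ℕ → ℕ := fun i => (b - i) + if i = 0 then e else 0
  have hh : Antitone h := antitone_nat_of_succ_le fun i => by simp [h]; omega
  have hD := isUpperSet_compl_staircase (b := b) hh
  obtain ⟨r, hr, hle⟩ := exists_pow_idealOfVars_le_restrictSupportIdeal_compl (k := k) hD
  rw [← idealOfVars_fin_two]
  refine ⟨restrictSupportIdeal (R := k) _ hD, r, hr, hle,
    restrictSupportIdeal_compl_le_idealOfVars hD ?_, ?_, ?_⟩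
  · rw [mem_staircase]
    simp [h]
    omega
  · rw [finrank_quotient_restrictSupportIdeal_compl, card_staircase, Finset.sum_add_distrib,
      Finset.sum_ite_eq' (Finset.range b) 0 fun _ => e, if_pos (Finset.mem_range.mpr hb1)]
    omega
  · rw [finrank_socle_restrictSupportIdeal_compl hD (mem_corners_staircase_iff
      (fun i hi => by simp [h]; omega) (fun i hi => by simp [h]; omega)),
      Finset.card_image_of_injective, Finset.card_range]
    exact fun i j hij => by simpa using (exponent_eq_iff.mp hij).1
end
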